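/- arXiv:2504.21057 — 2 statements merged into one kernel-verified Lean document; each statement's English description precedes it below -/
import Mathlib

section
/- Let f, g : S → ℂ satisfy the integral Kannappan-sine addition law ∫_S f(xσ(y)t) dμ(t) = f(x)g(y) + f(y)g(x) for all x, y ∈ S, with ∫_S f(t) dμ(t) = 0 and f, g linearly independent over ℂ. Then ∫_S g(t) dμ(t) ≠ 0. -/
/-- Integral of `h` against a finitely supported complex measure `μ` on `S`:
`∫_S h(t) dμ(t) = Σ_t μ(t) h(t)`. -/
noncomputable def mint {S : Type*} (μ : S →₀ ℂ) (h : S → ℂ) : ℂ :=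
  μ.sum fun t c => c * h t

theorem mint_add {S : Type*} (μ : S →₀ ℂ) (h k : S → ℂ) :
    mint μ (fun t => h t + k t) = mint μ h + mint μ k := by
  simp [mint, Finsupp.sum, mul_add, Finset.sum_add_distrib]

theorem mint_const_mul {S : Type*} (μ : S →₀ ℂ) (c : ℂ) (h : S → ℂ) :
    mint μ (fun t => c * h t) = c * mint μ h := by
  simp only [mint, Finsupp.sum, Finset.mul_sum]
  exact Finset.sum_congr rfl fun t _ => by ring

theorem mint_mul_const {S : Type*} (μ : S →₀ ℂ) (h : S → ℂ) (c : ℂ) :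
    mint μ (fun t => h t * c) = mint μ h * c := by
  simp only [mint, Finsupp.sum, Finset.sum_mul]
  exact Finset.sum_congr rfl fun t _ => by ring

/-- The Fubini theorem for finitely supported measures. -/
theorem mint_comm {S : Type*} (μ : S →₀ ℂ) (h : S → S → ℂ) :
    mint μ (fun s => mint μ (fun t => h s t)) = mint μ (fun t => mint μ (fun s => h s t)) := by
  simp only [mint, Finsupp.sum, Finset.mul_sum]
  rw [Finset.sum_comm]
  exact Finset.sum_congr rfl fun t _ => Finset.sum_congr rfl fun s _ => by ring

theorem stmt_12 {S : Type*} [Semigroup S] (σ : S → S)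
    (hσmul : ∀ x y : S, σ (x * y) = σ x * σ y) (hσinv : ∀ x : S, σ (σ x) = x)
    (μ : S →₀ ℂ) (f g : S → ℂ)
    (hf : ∀ x y : S, mint μ (fun t => f (x * σ y * t)) = f x * g y + f y * g x)
    (hf0 : mint μ f = 0)
    (hli : ∀ a b : ℂ, (∀ x : S, a * f x + b * g x = 0) → a = 0 ∧ b = 0) :
    mint μ g ≠ 0 := by
  intro hg0
  obtain ⟨y₀, hy₀⟩ : ∃ y, f y ≠ 0 := by
    by_contra! h
    exact one_ne_zero (hli 1 0 fun x => by simp [h]).1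
  obtain ⟨z₀, hz₀⟩ : ∃ y, g y ≠ 0 := by
    by_contra! h
    exact one_ne_zero (hli 0 1 fun x => by simp [h]).2
  obtain ⟨a₀, b₀, hab⟩ : ∃ a b, f a * g b + f b * g a ≠ 0 := by
    by_contra! h
    exact hy₀ (hli (g y₀) (f y₀) fun x => by linear_combination h x y₀).2
  -- Integrals of left translates of `f` and `g` vanish.
  have left (x : S) : mint μ (fun s => f (s * x)) = 0 ∧ mint μ (fun s => g (s * x)) = 0 := by
    have key (y : S) : mint μ (fun s => g (s * x)) * f y + mint μ (fun s => f (s * x)) * g y = 0 := by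
      have h1 (s : S) : f (s * x) * g y + f y * g (s * x)
          = f s * g (σ x * y) + f (σ x * y) * g s := by
        rw [← hf, ← hf]; simp only [hσmul, hσinv, mul_assoc]
      have h2 := congrArg (mint μ) (funext h1)
      simp only [mint_add, mint_const_mul, mint_mul_const, hf0, hg0] at h2
      linear_combination h2
    exact (hli _ _ key).symm
  set F : S → ℂ := fun x => mint μ (fun t => f (x * t))
  set G : S → ℂ := fun x => mint μ (fun t => g (x * t))
  set M : S → S → ℂ := fun b y => mint μ (fun s => f (b * (σ s * y))) with hM
  set N : S → S → ℂ := fun b y => mint μ (fun s => g (b * (σ s * y)))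
  have hFxy (x y : S) : F (x * σ y) = f x * g y + f y * g x := hf x y
  have hMN (a b y : S) : f y * G (a * σ b)
      = f a * (N b y - g b * g y) + g a * (M b y - f b * g y) := by
    have h1 (s : S) : f (a * σ b * s) * g y + f y * g (a * σ b * s)
        = f a * g (b * (σ s * y)) + f (b * (σ s * y)) * g a := by
      rw [← hf, ← hf]; simp only [hσmul, hσinv, mul_assoc]
    have h2 := congrArg (mint μ) (funext h1)
    simp only [mint_add, mint_const_mul, mint_mul_const] at h2
    change F (a * σ b) * g y + f y * G (a * σ b) = f a * N b y + M b y * g a at h2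
    rw [hFxy] at h2
    linear_combination h2
  obtain ⟨p, q, hpq⟩ : ∃ p q : S → ℂ, ∀ a b, G (a * σ b) = f a * p b + g a * q b := by
    refine ⟨fun b => (N b y₀ - g b * g y₀) / f y₀, fun b => (M b y₀ - f b * g y₀) / f y₀,
      fun a b => ?_⟩
    field_simp
    linear_combination hMN a b y₀
  have hind (b y : S) : N b y - g b * g y - f y * p b = 0 ∧ M b y - f b * g y - f y * q b = 0 :=
    hli _ _ fun a => by linear_combination f y * hpq a b - hMN a b y
  have hFG (b y : S) : f b * G y + F y * q b = 0 := by
    have h1 : mint μ (fun c => M b (y * c)) = 0 := by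
      simp only [hM]
      rw [mint_comm]
      have h2 (s : S) : mint μ (fun c => f (b * (σ s * (y * c))))
          = f b * g (s * σ y) + f (s * σ y) * g b := by
        rw [← hf]; simp only [hσmul, hσinv, mul_assoc]
      simp only [h2, mint_add, mint_const_mul, mint_mul_const, (left (σ y)).1, (left (σ y)).2]
      ring
    have h3 (c : S) : M b (y * c) = f b * g (y * c) + f (y * c) * q b := by
      linear_combination (hind b (y * c)).2
    simp only [h3, mint_add, mint_const_mul, mint_mul_const] at h1
    exact h1
  obtain ⟨l, hq⟩ : ∃ l : ℂ, ∀ b, q b = l * f b := by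
    have hne : F (a₀ * σ b₀) ≠ 0 := by rwa [hFxy]
    refine ⟨-G (a₀ * σ b₀) / F (a₀ * σ b₀), fun b => ?_⟩
    field_simp
    linear_combination hFG b (a₀ * σ b₀)
  have hGF (y : S) : G y = -l * F y := by
    have h := hFG y₀ y
    rw [hq] at h
    exact mul_left_cancel₀ hy₀ (by linear_combination h)
  have hpl (b : S) : p b + l * g b = 0 ∧ 2 * l * f b = 0 :=
    hli _ _ fun a => by
      have h := hpq a b
      rw [hGF, hFxy, hq] at h
      linear_combination -h
  have hl : l = 0 := by simpa [hy₀] using (hpl y₀).2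
  subst hl
  have hM' (b y : S) : M b y = f b * g y := by
    linear_combination (hind b y).2 + f y * hq b
  have hN' (b y : S) : N b y = g b * g y := by
    linear_combination (hind b y).1 + f y * (hpl b).1
  have hG0 (y : S) : G y = 0 := by simp [hGF]
  have h1 (s : S) : mint μ (fun t => f (a₀ * (σ s * (z₀ * σ b₀ * t))))
      = f (a₀ * (σ s * z₀)) * g b₀ + f b₀ * g (a₀ * (σ s * z₀)) := by
    rw [← hf]; simp only [mul_assoc]
  have h2 := congrArg (mint μ) (funext h1)
  rw [mint_comm] at h2
  simp only [mint_add, mint_const_mul, mint_mul_const] at h2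
  change mint μ (fun t => M a₀ (z₀ * σ b₀ * t)) = M a₀ z₀ * g b₀ + f b₀ * N a₀ z₀ at h2
  simp only [hM', hN', mint_const_mul] at h2
  change f a₀ * G (z₀ * σ b₀) = _ at h2
  rw [hG0] at h2
  exact mul_ne_zero hz₀ hab (by linear_combination -h2)
end

section
/- Let α ∈ ℂ\{0} and let χ₁, χ₂ be exponentials on S with χ₁∘σ = χ₁, χ₂∘σ = χ₂, ∫_S χ₁(t) dμ(t) ≠ 0 and ∫_S χ₂(t) dμ(t) ≠ 0. Then f := (1/(2α))[(∫_S χ₁ dμ)χ₁ − (∫_S χ₂ dμ)χ₂] and g := (1/2)[(∫_S χ₁ dμ)χ₁ + (∫_S χ₂ dμ)χ₂] satisfy ∫_S f(xσ(y)t) dμ(t) = f(x)g(y) + f(y)g(x) for all x, y ∈ S. -/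
theorem mint_linear_combination {S : Type*} (μ : S →₀ ℂ) (a b : ℂ) (h k : S → ℂ) :
    mint μ (fun t => a * h t + b * k t) = a * mint μ h + b * mint μ k := by
  simp only [mint, Finsupp.sum, Finset.mul_sum, ← Finset.sum_add_distrib]
  exact Finset.sum_congr rfl fun t _ => by ring

theorem stmt_17 {S : Type*} [Semigroup S] (σ : S → S)
    (hσmul : ∀ x y : S, σ (x * y) = σ x * σ y) (hσinv : ∀ x : S, σ (σ x) = x)
    (μ : S →₀ ℂ) (α : ℂ) (hα : α ≠ 0)
    (χ₁ χ₂ : S → ℂ)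
    (hχ₁mul : ∀ x y : S, χ₁ (x * y) = χ₁ x * χ₁ y) (hχ₁0 : χ₁ ≠ 0)
    (hχ₂mul : ∀ x y : S, χ₂ (x * y) = χ₂ x * χ₂ y) (hχ₂0 : χ₂ ≠ 0)
    (hχ₁σ : ∀ x : S, χ₁ (σ x) = χ₁ x) (hχ₂σ : ∀ x : S, χ₂ (σ x) = χ₂ x)
    (hint1 : mint μ χ₁ ≠ 0) (hint2 : mint μ χ₂ ≠ 0)
    (f g : S → ℂ)
    (hfdef : f = fun x => (1 / (2 * α)) * (mint μ χ₁ * χ₁ x - mint μ χ₂ * χ₂ x))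
    (hgdef : g = fun x => (1 / 2 : ℂ) * (mint μ χ₁ * χ₁ x + mint μ χ₂ * χ₂ x)) :
    ∀ x y : S, mint μ (fun t => f (x * σ y * t)) = f x * g y + f y * g x := by
  intro x y
  have key : (fun t => f (x * σ y * t)) = fun t =>
      (1 / (2 * α) * mint μ χ₁ * χ₁ x * χ₁ y) * χ₁ t +
        (-(1 / (2 * α) * mint μ χ₂ * χ₂ x * χ₂ y)) * χ₂ t := by
    funext t
    simp only [hfdef, hχ₁mul, hχ₂mul, hχ₁σ, hχ₂σ]
    ring
  rw [key, mint_linear_combination]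
  simp only [hfdef, hgdef]
  ring
end
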